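/- Let ζ₃ be a primitive third root of unity in a field L ⊇ K containing α with α ≠ 0, and let G ⊆ Aut(L(t)/L) be the group generated by φ₁: t ↦ α/t and φ₂: t ↦ αζ₃/t. Then G has order 6, the element s' := t³ + α³/t³ is fixed by G, and the fixed field L(t)^G equals L(s'). -/

import Mathlib

open IntermediateField Module Polynomial

/-- If `[E : K] ≤ n` and `G` is a group of automorphisms fixing `K` whose order is divisible by `n`,
then `G` has order `n` and fixed field `K`. -/
theorem IntermediateField.card_eq_and_fixedField_eq_of_dvd_card {F E : Type*} [Field F] [Field E]
    [Algebra F E] (K : IntermediateField F E) [FiniteDimensional K E] (G : Subgroup Gal(E/F))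
    {n : ℕ} (hK : K ≤ fixedField G) (hn : finrank K E ≤ n) (hG : n ∣ Nat.card G) :
    Nat.card G = n ∧ fixedField G = K := by
  have hle : G ≤ fixingSubgroup K := (le_iff_le _ _).mp hK
  have : Finite (fixingSubgroup K) := .of_equiv _ (fixingSubgroupEquiv K).symm.toEquiv
  have : Finite G := .of_injective _ (Subgroup.inclusion_injective hle)
  have : Fintype G := .ofFinite G
  have hcard : Nat.card G ≤ finrank K E := calc
    Nat.card G ≤ Nat.card (fixingSubgroup K) :=
      Nat.card_le_card_of_injective _ (Subgroup.inclusion_injective hle)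
    _ = Nat.card Gal(E/K) := Nat.card_congr (fixingSubgroupEquiv K).toEquiv
    _ ≤ finrank K E := by rw [Nat.card_eq_fintype_card]; exact AlgEquiv.card_le
  have hGn : Nat.card G = n := (hcard.trans hn).antisymm (Nat.le_of_dvd Nat.card_pos hG)
  have hfix : finrank (fixedField G) E = Nat.card G :=
    (FixedPoints.finrank_eq_card G E).trans Nat.card_eq_fintype_card.symm
  exact ⟨hGn, (eq_of_le_of_finrank_eq' hK (by lia)).symm⟩

/-- An `L`-automorphism of `L(t)` is determined by the image of `t`. -/
theorem RatFunc.algEquiv_ext_X {L : Type*} [Field L] {σ τ : RatFunc L ≃ₐ[L] RatFunc L}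
    (h : σ RatFunc.X = τ RatFunc.X) : σ = τ := by
  have hle : L⟮(RatFunc.X : RatFunc L)⟯ ≤ fixedField (Subgroup.zpowers (τ⁻¹ * σ)) := by
    rw [adjoin_simple_le_iff, mem_fixedField_iff]
    intro f hf
    have : Subgroup.zpowers (τ⁻¹ * σ) ≤ MulAction.stabilizer _ (RatFunc.X : RatFunc L) := by
      rw [Subgroup.zpowers_le, MulAction.mem_stabilizer_iff, mul_smul, inv_smul_eq_iff]
      exact h
    exact this hf
  ext x
  have hx := (mem_fixedField_iff _ x).mp (hle (RatFunc.adjoin_X (K := L) ▸ mem_top))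
    _ (Subgroup.mem_zpowers _)
  exact inv_smul_eq_iff.mp (show τ⁻¹ • σ x = x from hx)

/-- `L(t)` is finite of degree at most `p.natDegree` over any intermediate field over which `t` is
a root of the monic polynomial `p`. -/
theorem RatFunc.finiteDimensional_and_finrank_le {L : Type*} [Field L]
    (K : IntermediateField L (RatFunc L)) {p : K[X]} (hp : p.Monic)
    (hroot : aeval (RatFunc.X : RatFunc L) p = 0) :
    FiniteDimensional K (RatFunc L) ∧ finrank K (RatFunc L) ≤ p.natDegree := by
  have hint : IsIntegral K (RatFunc.X : RatFunc L) := ⟨p, hp, hroot⟩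
  have e := (RatFunc.IntermediateField.adjoinXEquiv K).toLinearEquiv
  have := adjoin.finiteDimensional hint
  refine ⟨.of_surjective e.toLinearMap e.surjective, ?_⟩
  rw [← e.finrank_eq, adjoin.finrank hint]
  exact natDegree_le_natDegree (minpoly.min K _ hp hroot)

/-- The automorphism `t ↦ β/t` is an involution. -/
theorem RatFunc.sq_eq_one_of_map_X_eq_div {L : Type*} [Field L] {β : L} (hβ : β ≠ 0)
    {φ : RatFunc L ≃ₐ[L] RatFunc L} (hφ : φ RatFunc.X = RatFunc.C β / RatFunc.X) :
    φ ^ 2 = 1 := by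
  have hC : RatFunc.C β ≠ 0 := by simpa using hβ
  have hfix : φ (RatFunc.C β) = RatFunc.C β := φ.commutes β
  apply RatFunc.algEquiv_ext_X
  rw [pow_two, AlgEquiv.mul_apply, hφ, map_div₀, hfix, hφ, AlgEquiv.one_apply, div_div_cancel₀ hC]

/-- The automorphism `t ↦ β/t` fixes `t³ + α³/t³` if `β³ = α³`. -/
theorem RatFunc.map_cube_add_eq_of_map_X_eq_div {L : Type*} [Field L] {α β : L} (hα : α ≠ 0)
    (h : β ^ 3 = α ^ 3) {φ : RatFunc L ≃ₐ[L] RatFunc L}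
    (hφ : φ RatFunc.X = RatFunc.C β / RatFunc.X) :
    φ (RatFunc.X ^ 3 + RatFunc.C (α ^ 3) / RatFunc.X ^ 3) =
      RatFunc.X ^ 3 + RatFunc.C (α ^ 3) / RatFunc.X ^ 3 := by
  have hC : RatFunc.C (α ^ 3) ≠ 0 := by simpa using hα
  have hfix : φ (RatFunc.C (α ^ 3)) = RatFunc.C (α ^ 3) := φ.commutes _
  rw [map_add, map_div₀, map_pow, hfix, hφ, div_pow, ← map_pow, h, div_div_cancel₀ hC, add_comm]

/-- Involutions whose product has order `3` generate a group of order divisible by `6`. -/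
theorem Subgroup.six_dvd_card_closure_pair {G : Type*} [Group G] {a b : G} (ha : a ^ 2 = 1)
    (hb : b ^ 2 = 1) (hab : (a * b) ^ 3 = 1) (hne : a * b ≠ 1) :
    6 ∣ Nat.card (closure {a, b}) := by
  have ha1 : a ≠ 1 := by
    rintro rfl
    rw [one_mul] at hab hne
    exact hne (by simpa [pow_succ, hb] using (pow_succ b 2).symm.trans hab)
  have hamem : a ∈ closure {a, b} := subset_closure (by simp)
  have hbmem : b ∈ closure {a, b} := subset_closure (by simp)
  have hthree := orderOf_dvd_natCard _ (mul_mem hamem hbmem)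
  have htwo := orderOf_dvd_natCard _ hamem
  rw [orderOf_eq_prime hab hne] at hthree
  rw [orderOf_eq_prime ha ha1] at htwo
  lia

/-- The group generated by `t ↦ α/t` and `t ↦ αζ₃/t` has order 6, fixes
`s' = t³ + α³/t³`, and its fixed field is `L(s')`. -/
theorem fixed_field_of_involutions {L : Type*} [Field L] [CharZero L]
    (ζ : L) (hζ : IsPrimitiveRoot ζ 3) (α : L) (hα : α ≠ 0)
    (φ₁ φ₂ : RatFunc L ≃ₐ[L] RatFunc L)
    (hφ₁ : φ₁ RatFunc.X = RatFunc.C α / RatFunc.X)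
    (hφ₂ : φ₂ RatFunc.X = RatFunc.C (α * ζ) / RatFunc.X) :
    ∀ G : Subgroup (RatFunc L ≃ₐ[L] RatFunc L), G = Subgroup.closure {φ₁, φ₂} →
    ∀ s' : RatFunc L, s' = RatFunc.X ^ 3 + RatFunc.C (α ^ 3) / RatFunc.X ^ 3 →
      Nat.card G = 6 ∧ (∀ σ ∈ G, σ s' = s') ∧
        IntermediateField.fixedField G = IntermediateField.adjoin L {s'} := by
  rintro G rfl s' hs'
  have hX : (RatFunc.X : RatFunc L) ≠ 0 := RatFunc.X_ne_zero
  have hCα : RatFunc.C α ≠ 0 := by simpa using hα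
  have hζ0 : ζ ≠ 0 := hζ.ne_zero (by norm_num)
  have hfixed : ∀ σ ∈ Subgroup.closure {φ₁, φ₂}, σ s' = s' := by
    have hle : Subgroup.closure {φ₁, φ₂} ≤ MulAction.stabilizer _ s' := by
      rw [Subgroup.closure_le, Set.pair_subset_iff, hs']
      exact ⟨RatFunc.map_cube_add_eq_of_map_X_eq_div hα rfl hφ₁,
        RatFunc.map_cube_add_eq_of_map_X_eq_div hα (by rw [mul_pow, hζ.pow_eq_one, mul_one]) hφ₂⟩
    exact fun σ hσ ↦ hle hσ
  have hmul : (φ₁ * φ₂) RatFunc.X = RatFunc.C ζ * RatFunc.X := by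
    have hfix : φ₁ (RatFunc.C (α * ζ)) = RatFunc.C (α * ζ) := φ₁.commutes _
    rw [AlgEquiv.mul_apply, hφ₂, map_div₀, hfix, hφ₁, map_mul]
    field_simp
  have hcube : (φ₁ * φ₂) ^ 3 = 1 := by
    have hfix : (φ₁ * φ₂) (RatFunc.C ζ) = RatFunc.C ζ := (φ₁ * φ₂).commutes ζ
    apply RatFunc.algEquiv_ext_X
    have hζC : RatFunc.C ζ ^ 3 = 1 := by rw [← map_pow, hζ.pow_eq_one, map_one]
    rw [pow_three, AlgEquiv.mul_apply (φ₁ * φ₂), AlgEquiv.mul_apply (φ₁ * φ₂), hmul, map_mul, hfix,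
      hmul, map_mul, map_mul, hfix, hmul, AlgEquiv.one_apply]
    linear_combination RatFunc.X * hζC
  have hne : φ₁ * φ₂ ≠ 1 := by
    intro h
    rw [h, AlgEquiv.one_apply, eq_comm, mul_eq_right₀ hX, ← map_one RatFunc.C] at hmul
    exact hζ.ne_one (by norm_num) (RatFunc.C_injective hmul)
  have hdvd := Subgroup.six_dvd_card_closure_pair (RatFunc.sq_eq_one_of_map_X_eq_div hα hφ₁)
    (RatFunc.sq_eq_one_of_map_X_eq_div (mul_ne_zero hα hζ0) hφ₂) hcube hne
  let p : L⟮s'⟯[X] := X ^ 6 - C (AdjoinSimple.gen L s') * X ^ 3 + C (algebraMap L _ (α ^ 3))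
  have hdeg : p.natDegree = 6 := by unfold p; compute_degree!
  have hp : p.Monic := by unfold p; monicity!
  have hroot : aeval (RatFunc.X : RatFunc L) p = 0 := by
    have hgen : algebraMap L⟮s'⟯ (RatFunc L) (AdjoinSimple.gen L s') = s' :=
      AdjoinSimple.algebraMap_gen L s'
    have hconst : algebraMap L⟮s'⟯ (RatFunc L) (algebraMap L _ (α ^ 3)) = RatFunc.C (α ^ 3) := rfl
    simp only [p, map_add, map_sub, map_mul, map_pow, aeval_X, aeval_C, hgen]
    simp only [← map_pow, hconst, hs']
    field_simp
    ring
  obtain ⟨hfin, hrank⟩ := RatFunc.finiteDimensional_and_finrank_le L⟮s'⟯ hp hroot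
  obtain ⟨hcard, hfield⟩ := card_eq_and_fixedField_eq_of_dvd_card L⟮s'⟯ _
    (by rwa [adjoin_simple_le_iff, mem_fixedField_iff]) (hrank.trans hdeg.le) hdvd
  exact ⟨hcard, hfixed, hfield⟩
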